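/- Let f : ℝ³ → ℝ be smooth with compact support and let ψ(z) = ‖z‖. Then the Rosenbluth potential g = ψ⋆f satisfies the biharmonic equation −Δ²g = 8π f; that is, for every v ∈ ℝ³, Δ(Δ(ψ⋆f))(v) = −8π f(v). -/

import Mathlib

open Real MeasureTheory
noncomputable section

/-- Partial derivative in the `i`-th coordinate direction. -/
def pd (i : Fin 3) (f : EuclideanSpace ℝ (Fin 3) → ℝ) :
    EuclideanSpace ℝ (Fin 3) → ℝ :=
  fun v => fderiv ℝ f v (EuclideanSpace.single i 1)

/-- The Laplacian `Δf = Σ_j ∂_j² f`. -/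
def lap (f : EuclideanSpace ℝ (Fin 3) → ℝ) : EuclideanSpace ℝ (Fin 3) → ℝ :=
  fun v => ∑ j, pd j (pd j f) v

open Filter Topology Set

abbrev E3 := EuclideanSpace ℝ (Fin 3)

lemma pd_contDiff {g : E3 → ℝ} (hg : ContDiff ℝ (⊤ : ℕ∞) g) (i : Fin 3) :
    ContDiff ℝ (⊤ : ℕ∞) (pd i g) := by
  have h : ContDiff ℝ (⊤ : ℕ∞) (fderiv ℝ g) := hg.fderiv_right (by simp)
  exact h.clm_apply contDiff_const

lemma pd_supp {g : E3 → ℝ} (hg : HasCompactSupport g) (i : Fin 3) :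
    HasCompactSupport (pd i g) := by
  have h := hg.fderiv ℝ
  exact h.comp_left (g := fun L : E3 →L[ℝ] ℝ => L (EuclideanSpace.single i 1)) (by simp)

lemma lap_contDiff {g : E3 → ℝ} (hg : ContDiff ℝ (⊤ : ℕ∞) g) :
    ContDiff ℝ (⊤ : ℕ∞) (lap g) := by
  unfold lap
  exact ContDiff.sum fun i _ => pd_contDiff (pd_contDiff hg i) i

lemma lap_supp {g : E3 → ℝ} (hg : HasCompactSupport g) : HasCompactSupport (lap g) := by
  have h := fun i => pd_supp (pd_supp hg i) i
  have : lap g = pd 0 (pd 0 g) + pd 1 (pd 1 g) + pd 2 (pd 2 g) := by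
    ext v; simp [lap, Fin.sum_univ_three]
  rw [this]
  exact ((h 0).add (h 1)).add (h 2)

lemma pd_conv {g : E3 → ℝ} (hg : ContDiff ℝ (⊤ : ℕ∞) g) (hs : HasCompactSupport g) (i : Fin 3) :
    pd i (fun x => ∫ u, ‖u‖ * g (x - u)) = fun x => ∫ u, ‖u‖ * pd i g (x - u) := by
  ext x
  have hl : LocallyIntegrable (fun u : E3 => ‖u‖) volume := continuous_norm.locallyIntegrable
  have h := hs.hasFDerivAt_convolution_right (ContinuousLinearMap.mul ℝ ℝ) (μ := volume) hl
    (hg.of_le (by simp)) x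
  have h2 := convolution_precompR_apply (ContinuousLinearMap.mul ℝ ℝ) (μ := volume) hl
    (hs.fderiv ℝ) (hg.continuous_fderiv (by simp)) x (EuclideanSpace.single i (1:ℝ))
  unfold pd
  have h3 := congrArg (fun L => L (EuclideanSpace.single i (1:ℝ))) h.fderiv
  exact h3.trans h2

lemma int_mul {a g : E3 → ℝ} (ha : Continuous a) (hg : Continuous g) (hs : HasCompactSupport g) :
    Integrable (fun u => a u * g u) :=
  (ha.mul hg).integrable_of_hasCompactSupport hs.mul_left

lemma lap_conv {g : E3 → ℝ} (hg : ContDiff ℝ (⊤ : ℕ∞) g) (hs : HasCompactSupport g) :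
    lap (fun x => ∫ u, ‖u‖ * g (x - u)) = fun x => ∫ u, ‖u‖ * lap g (x - u) := by
  ext x
  have : ∀ i, pd i (pd i (fun x => ∫ u, ‖u‖ * g (x - u))) =
      fun x => ∫ u, ‖u‖ * pd i (pd i g) (x - u) := fun i => by
    rw [pd_conv hg hs, pd_conv (pd_contDiff hg i) (pd_supp hs i)]
  simp only [lap, this, Finset.mul_sum]
  rw [integral_finsetSum]
  intro i _
  have hh := pd_contDiff (pd_contDiff hg i) i
  have hc := pd_supp (pd_supp hs i) i
  exact int_mul (g := fun u => pd i (pd i g) (x - u)) continuous_norm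
    (hh.continuous.comp (by fun_prop))
    (hc.comp_homeomorph (Homeomorph.subLeft x))

lemma pd_refl {g : E3 → ℝ} (hg : ContDiff ℝ (⊤ : ℕ∞) g) (v : E3) (i : Fin 3) :
    pd i (fun u => g (v - u)) = fun u => - pd i g (v - u) := by
  ext u
  have h1 : HasFDerivAt (fun u => v - u) (-(ContinuousLinearMap.id ℝ E3)) u :=
    (hasFDerivAt_id u).const_sub v
  have h2 := ((hg.differentiable (by simp)) (v - u)).hasFDerivAt.comp u h1
  unfold pd
  have h3 := congrArg (fun L => L (EuclideanSpace.single i (1:ℝ))) h2.fderiv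
  refine h3.trans ?_
  simp

lemma pd_neg (g : E3 → ℝ) (i : Fin 3) : pd i (fun u => - g u) = fun u => - pd i g u := by
  ext u
  simp [pd]

lemma lap_refl {g : E3 → ℝ} (hg : ContDiff ℝ (⊤ : ℕ∞) g) (v : E3) :
    lap (fun u => g (v - u)) = fun u => lap g (v - u) := by
  ext u
  simp only [lap]
  refine Finset.sum_congr rfl fun i _ => ?_
  rw [pd_refl hg, pd_neg, pd_refl (pd_contDiff hg i)]
  simp

lemma pd_parts {a g : E3 → ℝ} (ha : ContDiff ℝ (⊤ : ℕ∞) a) (hg : ContDiff ℝ (⊤ : ℕ∞) g)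
    (hs : HasCompactSupport g) (i : Fin 3) :
    ∫ u, a u * pd i g u = - ∫ u, pd i a u * g u := by
  apply integral_mul_fderiv_eq_neg_fderiv_mul_of_integrable
  · exact int_mul (pd_contDiff ha i).continuous hg.continuous hs
  · exact int_mul ha.continuous (pd_contDiff hg i).continuous (pd_supp hs i)
  · exact int_mul ha.continuous hg.continuous hs
  · exact fun x _ => (ha.differentiable (by simp)) x
  · exact fun x _ => (hg.differentiable (by simp)) x

lemma lap_parts {a g : E3 → ℝ} (ha : ContDiff ℝ (⊤ : ℕ∞) a) (hg : ContDiff ℝ (⊤ : ℕ∞) g)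
    (hs : HasCompactSupport g) :
    ∫ u, a u * lap g u = ∫ u, lap a u * g u := by
  simp only [lap, Finset.mul_sum, Finset.sum_mul]
  rw [integral_finsetSum, integral_finsetSum]
  · refine Finset.sum_congr rfl fun i _ => ?_
    rw [pd_parts ha (pd_contDiff hg i) (pd_supp hs i), pd_parts (pd_contDiff ha i) hg hs, neg_neg]
  · exact fun i _ => int_mul (pd_contDiff (pd_contDiff ha i) i).continuous hg.continuous hs
  · exact fun i _ => int_mul ha.continuous (pd_contDiff (pd_contDiff hg i) i).continuous
      (pd_supp (pd_supp hs i) i)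

/-- regularised powers -/
def P (c a : ℝ) (u : E3) : ℝ := (‖u‖ ^ 2 + c) ^ a

lemma P_contDiff {c : ℝ} (hc : 0 < c) (a : ℝ) : ContDiff ℝ (⊤ : ℕ∞) (P c a) := by
  unfold P
  refine ContDiff.rpow_const_of_ne ((contDiff_norm_sq ℝ).add contDiff_const) fun x => ?_
  positivity

lemma pd_P {c : ℝ} (hc : 0 < c) (a : ℝ) (i : Fin 3) :
    pd i (P c a) = fun u => 2 * a * (u i * P c (a - 1) u) := by
  ext u
  have h1 : HasFDerivAt (fun u : E3 => ‖u‖ ^ 2 + c) _ u := (hasFDerivAt_id u).norm_sq.add_const c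
  have h2 := h1.rpow_const (p := a) (Or.inl (by positivity))
  have h3 := congrArg (fun L => L (EuclideanSpace.single i (1:ℝ))) h2.fderiv
  refine h3.trans ?_
  simp [P, EuclideanSpace.inner_single_right]
  ring

lemma pd_P2 {c : ℝ} (hc : 0 < c) (a : ℝ) (i : Fin 3) (u : E3) :
    pd i (pd i (P c a)) u = 2 * a * (P c (a - 1) u + 2 * (a - 1) * u i ^ 2 * P c (a - 2) u) := by
  rw [pd_P hc]
  have h0 : HasFDerivAt (fun u : E3 => u i) (EuclideanSpace.proj (𝕜 := ℝ) i : E3 →L[ℝ] ℝ) u :=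
    (EuclideanSpace.proj (𝕜 := ℝ) i : E3 →L[ℝ] ℝ).hasFDerivAt
  have h1 := ((P_contDiff hc (a - 1)).differentiable (by simp) u).hasFDerivAt
  have h2 := (h0.mul h1).const_mul (2 * a)
  have h3 := congrArg (fun L => L (EuclideanSpace.single i (1:ℝ))) h2.fderiv
  refine h3.trans ?_
  have h4 := congrFun (pd_P hc (a - 1) i) u
  unfold pd at h4
  simp [h4]
  rw [show a - 1 - 1 = a - 2 by ring]
  ring

lemma lap_P {c : ℝ} (hc : 0 < c) (a : ℝ) (u : E3) :
    lap (P c a) u = 2 * a * (2 * a + 1) * P c (a - 1) u - 4 * a * (a - 1) * c * P c (a - 2) u := by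
  have hn : ‖u‖ ^ 2 = u 0 ^ 2 + u 1 ^ 2 + u 2 ^ 2 := by
    simp [EuclideanSpace.norm_sq_eq, Fin.sum_univ_three]
  have h : P c (a - 1) u = (‖u‖ ^ 2 + c) * P c (a - 2) u := by
    have : (0:ℝ) < ‖u‖ ^ 2 + c := by positivity
    unfold P
    rw [show a - 1 = 1 + (a - 2) by ring, rpow_add this, rpow_one]
  simp only [lap, pd_P2 hc, Fin.sum_univ_three, h, hn]
  ring

lemma key {c : ℝ} (hc : 0 < c) {h : E3 → ℝ} (hh : ContDiff ℝ (⊤ : ℕ∞) h)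
    (hs : HasCompactSupport h) :
    ∫ u, P c (1/2) u * lap (lap h) u = -15 * c ^ 2 * ∫ u, P c (-7/2) u * h u := by
  have I : ∀ a, Integrable (fun u => P c a u * h u) := fun a =>
    int_mul (P_contDiff hc a).continuous hh.continuous hs
  have J : ∀ a, Integrable (fun u => P c a u * lap h u) := fun a =>
    int_mul (P_contDiff hc a).continuous (lap_contDiff hh).continuous (lap_supp hs)
  have e1 : ∫ u, P c (1/2) u * lap (lap h) u =
      2 * (∫ u, P c (-1/2) u * lap h u) + c * ∫ u, P c (-3/2) u * lap h u := by
    rw [lap_parts (P_contDiff hc _) (lap_contDiff hh) (lap_supp hs), ← integral_const_mul,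
      ← integral_const_mul, ← integral_add ((J _).const_mul _) ((J _).const_mul _)]
    congr 1; ext u
    rw [lap_P hc]; norm_num; ring
  have e2 : ∫ u, P c (-1/2) u * lap h u = - 3 * c * ∫ u, P c (-5/2) u * h u := by
    rw [lap_parts (P_contDiff hc _) hh hs, ← integral_const_mul]
    congr 1; ext u
    rw [lap_P hc]; norm_num; ring
  have e3 : ∫ u, P c (-3/2) u * lap h u =
      6 * (∫ u, P c (-5/2) u * h u) + (-15 * c) * ∫ u, P c (-7/2) u * h u := by
    rw [lap_parts (P_contDiff hc _) hh hs, ← integral_const_mul,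
      ← integral_const_mul, ← integral_add ((I _).const_mul _) ((I _).const_mul _)]
    congr 1; ext u
    rw [lap_P hc]; norm_num; ring
  rw [e1, e2, e3]; ring

lemma scale {ε : ℝ} (hε : 0 < ε) (h : E3 → ℝ) :
    (ε ^ 2) ^ 2 * ∫ u, P (ε ^ 2) (-7/2) u * h u = ∫ w, P 1 (-7/2) w * h (ε • w) := by
  have := Measure.integral_comp_smul (volume : Measure E3)
    (fun u => P (ε ^ 2) (-7/2) u * h u) ε
  have h1 : ∀ w : E3, P (ε ^ 2) (-7/2) (ε • w) = (ε ^ 7)⁻¹ * P 1 (-7/2) w := by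
    intro w
    unfold P
    rw [norm_smul, Real.norm_of_nonneg hε.le,
      show (ε * ‖w‖) ^ 2 + ε ^ 2 = ε ^ 2 * (‖w‖ ^ 2 + 1) by ring,
      mul_rpow (by positivity) (by positivity), ← rpow_natCast ε 2, ← rpow_mul hε.le,
      ← rpow_natCast ε 7, ← rpow_neg hε.le]
    norm_num
  simp only [h1, mul_assoc, integral_const_mul, finrank_euclideanSpace, Fintype.card_fin,
    smul_eq_mul] at this
  rw [abs_of_pos (by positivity)] at this
  generalize (∫ u, P (ε ^ 2) (-7/2) u * h u) = A at this ⊢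
  generalize (∫ w, P 1 (-7/2) w * h (ε • w)) = B at this ⊢
  field_simp at this
  rw [this]; ring

lemma radial : ∫ y in Ioi (0:ℝ), y ^ 2 * (y ^ 2 + 1) ^ (-7/2 : ℝ) = 2 / 15 := by
  set t : ℝ → ℝ := fun y => y / √(y ^ 2 + 1) with ht
  have hlim : Tendsto t atTop (𝓝 1) := by
    have h1 : Tendsto (fun y : ℝ => (√(1 + (y⁻¹) ^ 2))⁻¹) atTop (𝓝 (√(1 + 0 ^ 2))⁻¹) := by
      refine Tendsto.inv₀ ?_ (by simp)
      exact ((tendsto_inv_atTop_zero.pow 2).const_add 1).sqrt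
    simp only [ne_eq, OfNat.ofNat_ne_zero, not_false_eq_true, zero_pow, add_zero, sqrt_one, inv_one] at h1
    refine h1.congr' ?_
    filter_upwards [eventually_gt_atTop 0] with y hy
    rw [ht]
    have : y ^ 2 + 1 = y ^ 2 * (1 + y⁻¹ ^ 2) := by field_simp
    simp only [this]
    rw [sqrt_mul (by positivity), sqrt_sq hy.le]
    field_simp
  have hd : ∀ y ∈ Ici (0:ℝ), HasDerivAt (fun y => t y ^ 3 / 3 - t y ^ 5 / 5)
      (y ^ 2 * (y ^ 2 + 1) ^ (-7/2 : ℝ)) y := by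
    intro y _
    have hp : 0 < y ^ 2 + 1 := by positivity
    have hq : 0 < √(y ^ 2 + 1) := by positivity
    have h1 : HasDerivAt (fun y : ℝ => y ^ 2 + 1) (2 * y) y := by
      simpa using (hasDerivAt_pow 2 y).add_const 1
    have h2 := (hasDerivAt_id y).div (h1.sqrt hp.ne') hq.ne'
    have h3 := ((h2.pow 3).div_const 3).sub ((h2.pow 5).div_const 5)
    refine h3.congr_deriv ?_
    have e : (y ^ 2 + 1) ^ (-7/2 : ℝ) = (√(y ^ 2 + 1) ^ 7)⁻¹ := by
      rw [sqrt_eq_rpow, ← rpow_natCast _ 7, ← rpow_mul hp.le, ← rpow_neg hp.le]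
      norm_num
    rw [e]
    have hy : y ^ 2 = √(y ^ 2 + 1) ^ 2 - 1 := by rw [sq_sqrt hp.le]; ring
    simp only [id, Pi.div_apply]
    set q := √(y ^ 2 + 1)
    clear_value q
    field_simp
    norm_num
    grind
  have := integral_Ioi_of_hasDerivAt_of_nonneg' hd (fun y _ => by positivity)
    (((hlim.pow 3).div_const 3).sub ((hlim.pow 5).div_const 5))
  rw [this]; simp [ht]; norm_num

lemma int_P : ∫ w, P 1 (-7/2) w = 8 * π / 15 := by
  have := integral_fun_norm_addHaar (volume : Measure E3) (fun r => (r ^ 2 + 1) ^ (-7/2 : ℝ))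
  unfold P
  rw [this]
  simp only [finrank_euclideanSpace, Fintype.card_fin, smul_eq_mul, nsmul_eq_mul, Measure.real,
    EuclideanSpace.volume_ball_fin_three]
  simp only [Nat.add_one_sub_one, radial]
  rw [ENNReal.toReal_mul, ENNReal.toReal_ofReal (by positivity)]
  simp; ring

lemma integrable_P : Integrable (P 1 (-7/2)) := by
  have := integrable_rpow_neg_one_add_norm_sq (μ := (volume : Measure E3)) (r := 7)
    (by simp; norm_num)
  refine this.congr (Eventually.of_forall fun x => ?_)
  simp [P, add_comm]

lemma lim_right {h : E3 → ℝ} (hh : Continuous h) (hs : HasCompactSupport h) :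
    Tendsto (fun ε : ℝ => ∫ w, P 1 (-7/2) w * h (ε • w)) (𝓝[>] 0) (𝓝 (8 * π / 15 * h 0)) := by
  obtain ⟨C, hC⟩ := hs.exists_bound_of_continuous hh
  rw [← int_P, ← integral_mul_const]
  have hP := (P_contDiff one_pos (-7/2)).continuous
  refine tendsto_integral_filter_of_dominated_convergence (fun w => P 1 (-7/2) w * C) ?_ ?_
    (integrable_P.mul_const C) ?_
  · exact Eventually.of_forall fun ε => (hP.mul (hh.comp (by fun_prop))).aestronglyMeasurable
  · refine Eventually.of_forall fun ε => Eventually.of_forall fun w => ?_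
    have : 0 ≤ P 1 (-7/2) w := by unfold P; positivity
    rw [norm_mul, Real.norm_of_nonneg this]
    gcongr
    exact hC _
  · refine Eventually.of_forall fun w => ?_
    refine Tendsto.const_mul _ (tendsto_nhdsWithin_of_tendsto_nhds ?_)
    have : Continuous fun ε : ℝ => h (ε • w) := hh.comp (by fun_prop)
    simpa using this.tendsto 0

lemma lim_left {k : E3 → ℝ} (hk : Continuous k) (hs : HasCompactSupport k) :
    Tendsto (fun ε : ℝ => ∫ w, P (ε ^ 2) (1/2) w * k w) (𝓝[>] 0) (𝓝 (∫ w, ‖w‖ * k w)) := by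
  have e : ∀ (ε : ℝ) w, P (ε ^ 2) (1/2) w = √(‖w‖ ^ 2 + ε ^ 2) := fun ε w => by
    rw [P, sqrt_eq_rpow]
  simp only [e]
  have hi : Integrable (fun w => √(‖w‖ ^ 2 + 1) * ‖k w‖) :=
    int_mul (a := fun w => √(‖w‖ ^ 2 + 1)) (by fun_prop) hk.norm hs.norm
  refine tendsto_integral_filter_of_dominated_convergence _ ?_ ?_ hi ?_
  · exact Eventually.of_forall fun ε =>
      (Continuous.mul (by fun_prop) hk).aestronglyMeasurable
  · have : ∀ᶠ ε : ℝ in 𝓝[>] 0, ε ∈ Ioo (0:ℝ) 1 := Ioo_mem_nhdsGT one_pos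
    filter_upwards [this] with ε hε
    refine Eventually.of_forall fun w => ?_
    rw [norm_mul, Real.norm_of_nonneg (sqrt_nonneg _)]
    gcongr
    nlinarith [hε.1, hε.2]
  · refine Eventually.of_forall fun w => ?_
    refine Tendsto.mul_const _ (tendsto_nhdsWithin_of_tendsto_nhds ?_)
    have : Continuous fun ε : ℝ => √(‖w‖ ^ 2 + ε ^ 2) := by fun_prop
    simpa using this.tendsto 0

lemma bilap {h : E3 → ℝ} (hh : ContDiff ℝ (⊤ : ℕ∞) h) (hs : HasCompactSupport h) :
    ∫ u, ‖u‖ * lap (lap h) u = -(8 * π) * h 0 := by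
  have h1 := lim_left (lap_contDiff (lap_contDiff hh)).continuous (lap_supp (lap_supp hs))
  have h2 := (lim_right hh.continuous hs).const_mul (-15)
  have h3 := h1.congr' (f₂ := fun ε : ℝ => -15 * ∫ w, P 1 (-7/2) w * h (ε • w)) (by
    filter_upwards [self_mem_nhdsWithin] with ε hε
    have hε : 0 < ε := hε
    rw [key (by positivity) hh hs, ← scale hε]; ring)
  rw [tendsto_nhds_unique h3 h2]; ring

/-- For `f` smooth with compact support, the Rosenbluth
potential `g = ψ⋆f` satisfies the biharmonic equation `−Δ²g = 8π f`, i.e.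
`Δ(Δ(ψ⋆f))(v) = −8π f(v)`. -/
theorem bilaplacian_rosenbluth
    (f : EuclideanSpace ℝ (Fin 3) → ℝ)
    (hf : ContDiff ℝ (⊤ : ℕ∞) f) (hsupp : HasCompactSupport f)
    (v : EuclideanSpace ℝ (Fin 3)) :
    lap (lap (fun x => ∫ u, ‖u‖ * f (x - u))) v = -(8 * π) * f v := by
  rw [lap_conv hf hsupp, lap_conv (lap_contDiff hf) (lap_supp hsupp)]
  have h := bilap (h := fun u => f (v - u)) (hf.comp (by fun_prop))
    (hsupp.comp_homeomorph (Homeomorph.subLeft v))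
  rw [lap_refl hf, lap_refl (lap_contDiff hf)] at h
  simpa using h
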